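/- Let n be a positive natural number, E = EuclideanSpace ℝ (Fin n), and let μ and ν be probability measures on E. Let π be a coupling of μ and ν such that (x, y) ↦ ‖x − y‖ is π-integrable, and suppose the diagonal is π-null, i.e. π({(x, y) | x = y}) = 0. Let f : E → ℝ be continuously differentiable, integrable with respect to both μ and ν, satisfying the Sobolev line constraint at (x, y) for every x in the support of μ and every y in the support of ν, and suppose ∫ f dμ − ∫ f dν = ∫ ‖x − y‖ dπ(x, y). Then for π-almost every (x, y): for every t ∈ [0,1], ∇f(t • x + (1 − t) • y) = (x − y) / ‖x − y‖. -/

import Mathlib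

open MeasureTheory

/-- The Sobolev line constraint at `(x, y)`. -/
def SobolevLineConstraint {n : ℕ} (f : EuclideanSpace ℝ (Fin n) → ℝ)
    (x y : EuclideanSpace ℝ (Fin n)) : Prop :=
  ∫ t in Set.Icc (0 : ℝ) 1, ‖gradient f (t • x + (1 - t) • y)‖ ^ 2 ≤ 1

/-- `π` is a coupling of `μ` and `ν`: its marginals are `μ` and `ν`. -/
def IsCoupling {n : ℕ} (μ ν : Measure (EuclideanSpace ℝ (Fin n)))
    (π : Measure (EuclideanSpace ℝ (Fin n) × EuclideanSpace ℝ (Fin n))) : Prop :=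
  π.map Prod.fst = μ ∧ π.map Prod.snd = ν

/-- The topological support of a measure. -/
def measureSupport {α : Type*} [TopologicalSpace α] [MeasurableSpace α]
    (μ : Measure α) : Set α :=
  {x | ∀ U ∈ nhds x, μ U ≠ 0}

lemma line_aux {n : ℕ} (f : EuclideanSpace ℝ (Fin n) → ℝ) (hf : ContDiff ℝ 1 f)
    (x y : EuclideanSpace ℝ (Fin n)) (hxy : x ≠ y) (hS : SobolevLineConstraint f x y) :
    f x - f y ≤ ‖x - y‖ ∧ (f x - f y = ‖x - y‖ → ∀ t ∈ Set.Icc (0 : ℝ) 1,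
      gradient f (t • x + (1 - t) • y) = ‖x - y‖⁻¹ • (x - y)) := by
  have hd : 0 < ‖x - y‖ := norm_pos_iff.2 (sub_ne_zero.2 hxy)
  set u := ‖x - y‖⁻¹ • (x - y) with hu
  have hun : ‖u‖ = 1 := by
    rw [hu, norm_smul, norm_inv, norm_norm, inv_mul_cancel₀ hd.ne']
  have hgc : Continuous (gradient f) := by
    have h1 : Continuous (fderiv ℝ f) := hf.continuous_fderiv (by norm_num)
    exact (InnerProductSpace.toDual ℝ (EuclideanSpace ℝ (Fin n))).symm.continuous.comp h1
  set g : ℝ → EuclideanSpace ℝ (Fin n) := fun t => gradient f (t • x + (1 - t) • y) with hg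
  have hgcont : Continuous g := hgc.comp (by fun_prop)
  have hS' : ∫ t in (0 : ℝ)..1, ‖g t‖ ^ 2 ≤ 1 := by
    rw [intervalIntegral.integral_of_le zero_le_one, ← integral_Icc_eq_integral_Ioc]
    exact hS
  have hder : ∀ t : ℝ, HasDerivAt (fun t : ℝ => f (t • x + (1 - t) • y))
      (inner ℝ (g t) (x - y)) t := by
    intro t
    have h1 : HasDerivAt (fun t : ℝ => t • x + (1 - t) • y) (x - y) t := by
      have := ((hasDerivAt_id t).smul_const x).add
        (((hasDerivAt_id t).const_sub 1).smul_const y)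
      refine this.congr_deriv ?_
      simp [sub_eq_add_neg]
    have h2 := (hf.differentiable (by norm_num) (t • x + (1 - t) • y)).hasFDerivAt
    have h3 := h2.comp_hasDerivAt t h1
    rw [hg]
    simp only [inner_gradient_left]
    exact h3
  have hftc : ∫ t in (0 : ℝ)..1, inner ℝ (g t) (x - y) = f x - f y := by
    rw [intervalIntegral.integral_eq_sub_of_hasDerivAt (fun t _ => hder t)
      (Continuous.intervalIntegrable (by fun_prop) _ _)]
    simp
  have hin : ∀ t, inner ℝ (g t) u = ‖x - y‖⁻¹ * inner ℝ (g t) (x - y) := by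
    intro t; rw [hu, inner_smul_right]
  have hexp : ∫ t in (0 : ℝ)..1, ‖g t - u‖ ^ 2 =
      (∫ t in (0 : ℝ)..1, ‖g t‖ ^ 2) - 2 * ‖x - y‖⁻¹ * (f x - f y) + 1 := by
    have : ∀ t, ‖g t - u‖ ^ 2 =
        ‖g t‖ ^ 2 - 2 * ‖x - y‖⁻¹ * inner ℝ (g t) (x - y) + 1 := by
      intro t
      rw [@norm_sub_sq_real, hun, hin]; ring
    simp_rw [this]
    rw [intervalIntegral.integral_add, intervalIntegral.integral_sub,
      intervalIntegral.integral_const_mul, hftc]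
    · simp
    all_goals exact Continuous.intervalIntegrable (by fun_prop) _ _
  have hnn : 0 ≤ ∫ t in (0 : ℝ)..1, ‖g t - u‖ ^ 2 :=
    intervalIntegral.integral_nonneg zero_le_one (fun t _ => by positivity)
  constructor
  · have h : ‖x - y‖⁻¹ * (f x - f y) ≤ 1 := by linarith
    rwa [inv_mul_le_iff₀ hd, mul_one] at h
  · intro he t ht
    by_contra hne
    have hpos : 0 < ∫ t in (0 : ℝ)..1, ‖g t - u‖ ^ 2 := by
      refine intervalIntegral.integral_pos zero_lt_one (by fun_prop)
        (fun t _ => by positivity) ⟨t, ht, ?_⟩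
      have : 0 < ‖g t - u‖ := norm_pos_iff.2 (sub_ne_zero.2 hne)
      positivity
    have h : ‖x - y‖⁻¹ * (f x - f y) = 1 := by rw [he, inv_mul_cancel₀ hd.ne']
    linarith

lemma support_aux {n : ℕ} (μ : Measure (EuclideanSpace ℝ (Fin n))) :
    ∀ᵐ x ∂μ, x ∈ measureSupport μ := by
  filter_upwards [Measure.support_mem_ae (μ := μ)] with x hx U hU
  exact (Measure.mem_support_iff_forall x |>.1 hx U hU).ne'

theorem gradient_property_of_optimal_sobolev_critic
    {n : ℕ} (hn : 0 < n)
    (μ ν : Measure (EuclideanSpace ℝ (Fin n)))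
    [IsProbabilityMeasure μ] [IsProbabilityMeasure ν]
    (π : Measure (EuclideanSpace ℝ (Fin n) × EuclideanSpace ℝ (Fin n)))
    (hπ : IsCoupling μ ν π)
    (hcost : Integrable (fun p : EuclideanSpace ℝ (Fin n) × EuclideanSpace ℝ (Fin n) =>
      ‖p.1 - p.2‖) π)
    (hdiag : π {p : EuclideanSpace ℝ (Fin n) × EuclideanSpace ℝ (Fin n) | p.1 = p.2} = 0)
    (f : EuclideanSpace ℝ (Fin n) → ℝ)
    (hf : ContDiff ℝ 1 f)
    (hμint : Integrable f μ) (hνint : Integrable f ν)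
    (hS : ∀ x ∈ measureSupport μ, ∀ y ∈ measureSupport ν, SobolevLineConstraint f x y)
    (heq : (∫ x, f x ∂μ) - (∫ y, f y ∂ν) =
      ∫ p : EuclideanSpace ℝ (Fin n) × EuclideanSpace ℝ (Fin n), ‖p.1 - p.2‖ ∂π) :
    ∀ᵐ p ∂π, ∀ t ∈ Set.Icc (0 : ℝ) 1,
      gradient f (t • p.1 + (1 - t) • p.2) = ‖p.1 - p.2‖⁻¹ • (p.1 - p.2) := by
  obtain ⟨h1, h2⟩ := hπ
  have a1 : ∀ᵐ p ∂π, p.1 ∈ measureSupport μ := by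
    have := support_aux μ
    nth_rw 2 [← h1] at this
    exact ae_of_ae_map measurable_fst.aemeasurable this
  have a2 : ∀ᵐ p ∂π, p.2 ∈ measureSupport ν := by
    have := support_aux ν
    nth_rw 2 [← h2] at this
    exact ae_of_ae_map measurable_snd.aemeasurable this
  have a3 : ∀ᵐ p ∂π, p.1 ≠ p.2 := by
    rw [ae_iff]; simpa using hdiag
  have i1 : Integrable (fun p : EuclideanSpace ℝ (Fin n) × EuclideanSpace ℝ (Fin n) =>
      f p.1) π := by
    rw [← h1] at hμint
    exact hμint.comp_measurable measurable_fst
  have i2 : Integrable (fun p : EuclideanSpace ℝ (Fin n) × EuclideanSpace ℝ (Fin n) =>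
      f p.2) π := by
    rw [← h2] at hνint
    exact hνint.comp_measurable measurable_snd
  have e1 : ∫ x, f x ∂μ = ∫ p, f p.1 ∂π := by
    rw [← h1]
    exact integral_map measurable_fst.aemeasurable hf.continuous.aestronglyMeasurable
  have e2 : ∫ x, f x ∂ν = ∫ p, f p.2 ∂π := by
    rw [← h2]
    exact integral_map measurable_snd.aemeasurable hf.continuous.aestronglyMeasurable
  have hle : ∀ᵐ p ∂π, f p.1 - f p.2 ≤ ‖p.1 - p.2‖ := by
    filter_upwards [a1, a2, a3] with p q1 q2 q3
    exact (line_aux f hf _ _ q3 (hS _ q1 _ q2)).1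
  rw [e1, e2, ← integral_sub i1 i2] at heq
  have hee := (integral_eq_iff_of_ae_le (i1.sub i2) hcost hle).1 heq
  filter_upwards [a1, a2, a3, hee] with p q1 q2 q3 q4
  exact (line_aux f hf _ _ q3 (hS _ q1 _ q2)).2 q4
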